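/- Let M be a 3-pseudomanifold with exactly n vertices, n ≥ 7, and let u be a vertex of M of degree 5. Then there exists a bistellar 1-move κ_β : M ↦ N such that the degree of u in N is 6. -/

import Mathlib

/-! Basic framework for finite simplicial complexes, pseudomanifolds and
bistellar moves, following Datta–Nilakantan. A complex is recorded as the
finite set of its faces (nonempty finite subsets of the vertex type). -/

namespace NPM

variable {α β : Type*} [DecidableEq α] [DecidableEq β]

/-- A "complex" datum: a finite family of finite subsets of `α`. -/
abbrev Complex (α : Type*) := Finset (Finset α)

/-- `K` is a simplicial complex: a nonempty collection of nonempty sets,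
closed under passing to nonempty subsets. -/
def IsComplex (K : Complex α) : Prop :=
  K.Nonempty ∧ (∀ σ ∈ K, σ.Nonempty) ∧ ∀ σ ∈ K, ∀ τ ⊆ σ, τ.Nonempty → τ ∈ K

/-- The vertex set of `K`. -/
def verts (K : Complex α) : Finset α := K.sup id

/-- `K` is pure of dimension `d`: every face is contained in a face with
`d+1` vertices. -/
def IsPure (K : Complex α) (d : ℕ) : Prop :=
  ∀ σ ∈ K, ∃ τ ∈ K, σ ⊆ τ ∧ τ.card = d + 1

/-- The facets ("`d`-faces") of a pure `d`-dimensional complex. -/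
def facets (K : Complex α) (d : ℕ) : Complex α := K.filter (fun σ => σ.card = d + 1)

/-- The link of a face `σ` in `K`. -/
def link (K : Complex α) (σ : Finset α) : Complex α :=
  K.filter (fun τ => Disjoint τ σ ∧ σ ∪ τ ∈ K)

/-- The degree of a face: the number of vertices of its link. -/
def degree (K : Complex α) (σ : Finset α) : ℕ := (verts (link K σ)).card

/-- A weak `d`-pseudomanifold: a pure `d`-dimensional complex in which every
`(d-1)`-face (i.e. face with `d` vertices) lies in exactly two facets. -/
def WeakPM (K : Complex α) (d : ℕ) : Prop :=
  IsComplex K ∧ IsPure K d ∧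
    ∀ σ ∈ K, σ.card = d → (K.filter fun τ => σ ⊆ τ ∧ τ.card = d + 1).card = 2

/-- Strong connectedness: any two facets are joined by a chain of facets in
which consecutive facets meet in a `(d-1)`-face. -/
def SConn (K : Complex α) (d : ℕ) : Prop :=
  ∀ σ ∈ facets K d, ∀ τ ∈ facets K d,
    Relation.ReflTransGen
      (fun a b => a ∈ facets K d ∧ b ∈ facets K d ∧ (a ∩ b).card = d) σ τ

/-- A `d`-pseudomanifold: a strongly connected weak `d`-pseudomanifold. -/
def IsPM (K : Complex α) (d : ℕ) : Prop := WeakPM K d ∧ SConn K d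

/-- Connectedness of a complex: the graph of vertices and edges is connected. -/
def Conn (K : Complex α) : Prop :=
  (verts K).Nonempty ∧ ∀ u ∈ verts K, ∀ v ∈ verts K,
    Relation.ReflTransGen (fun a b => a ≠ b ∧ ({a, b} : Finset α) ∈ K) u v

/-- A normal `d`-pseudomanifold: a connected weak `d`-pseudomanifold in which
the link of every face of dimension `≤ d - 2` is connected. -/
def NormalPM (K : Complex α) (d : ℕ) : Prop :=
  WeakPM K d ∧ Conn K ∧ ∀ σ ∈ K, σ.card + 1 ≤ d → Conn (link K σ)

/-- `K` is neighbourly: every pair of vertices forms an edge. -/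
def Neighbourly (K : Complex α) : Prop :=
  ∀ u ∈ verts K, ∀ v ∈ verts K, u ≠ v → ({u, v} : Finset α) ∈ K

/-- Isomorphism of complexes: a map injective on the vertex set carrying the
faces of `K` exactly onto the faces of `L`. -/
def Iso (K : Complex α) (L : Complex β) : Prop :=
  ∃ f : α → β, Set.InjOn f ↑(verts K) ∧ L = K.image (fun σ => σ.image f)

/-- The complex generated by a family of facets: all nonempty subsets. -/
def genCx (F : Finset (Finset α)) : Complex α :=
  F.biUnion fun σ => σ.powerset.filter (fun τ => τ.Nonempty)

/-- The standard sphere on the vertex set `B`: all nonempty proper subsets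
of `B`. -/
def stdSphere (B : Finset α) : Complex α :=
  B.powerset.filter fun τ => τ.Nonempty ∧ τ ≠ B

/-- In a weak `d`-pseudomanifold, a removable `(d-i)`-face `A`: its link is a
standard sphere `S^{i-1}_{i+1}(B)` with `B` not a face.  (For `d = 3`,
`i = 1` gives removable 2-faces and `i = 2` gives removable 1-faces.) -/
def RemovableFace (d i : ℕ) (K : Complex α) (A : Finset α) : Prop :=
  A ∈ K ∧ A.card = d - i + 1 ∧
    ∃ B : Finset α, B.card = i + 1 ∧ B ∉ K ∧ link K A = stdSphere B

/-- The bistellar `i`-move (`0 < i ≤ d`) relation on weak `d`-pseudomanifolds: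
`L` is obtained from `K` by removing a removable `(d-i)`-face `A` with
`link K A = stdSphere B` and inserting the facets `(B ∪ A) \ {v}`, `v ∈ A`. -/
def BMove (d i : ℕ) (K L : Complex α) : Prop :=
  ∃ A B : Finset α, A ∈ K ∧ A.card = d - i + 1 ∧ B.card = i + 1 ∧ B ∉ K ∧
    link K A = stdSphere B ∧
    L = genCx ((facets K d).filter (fun σ => ¬ A ⊆ σ) ∪
          A.image fun v => (B ∪ A).erase v)

/-- The bistellar `0`-move: star a new vertex `w` in a facet `σ`. -/
def BMove0 (d : ℕ) (K L : Complex α) : Prop :=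
  ∃ σ w, σ ∈ K ∧ σ.card = d + 1 ∧ w ∉ verts K ∧
    L = genCx (((facets K d).erase σ) ∪ σ.image fun v => insert w (σ.erase v))

/-- A single bistellar move of any type `0 ≤ i ≤ d`. -/
def BStep (d : ℕ) (K L : Complex α) : Prop :=
  BMove0 d K L ∨ ∃ i, 0 < i ∧ i ≤ d ∧ BMove d i K L

/-- Bistellar equivalence: a finite sequence of bistellar moves. -/
def BEquiv (d : ℕ) : Complex α → Complex α → Prop :=
  Relation.ReflTransGen (BStep d)

/-- A proper bistellar move: a bistellar `i`-move with `0 < i < d`. -/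
def PMove (d : ℕ) (K L : Complex α) : Prop := ∃ i, 0 < i ∧ i < d ∧ BMove d i K L

/-- Proper bistellar equivalence. -/
def PEquiv (d : ℕ) : Complex α → Complex α → Prop :=
  Relation.ReflTransGen (PMove d)

/-- The result of the bistellar move on the face `A` of the weak
`d`-pseudomanifold `K` (deterministic form: `B` is the vertex set of
`link K A`). -/
def kappa (d : ℕ) (K : Complex α) (A : Finset α) : Complex α :=
  genCx ((facets K d).filter (fun σ => ¬ A ⊆ σ) ∪
    A.image fun v => (verts (link K A) ∪ A).erase v)

/-- A cycle: a (finite) 1-pseudomanifold. -/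
def Cycle (K : Complex α) : Prop := IsPM K 1

/-- A combinatorial 2-manifold: a weak 2-pseudomanifold all whose vertex
links are cycles. -/
def Comb2Mfd (K : Complex α) : Prop :=
  WeakPM K 2 ∧ ∀ v, ({v} : Finset α) ∈ K → Cycle (link K {v})

/-- The Euler characteristic `f₀ - f₁ + f₂` of a 2-dimensional complex. -/
def eulerChar (K : Complex α) : ℤ :=
  ((K.filter fun σ => σ.card = 1).card : ℤ) -
    ((K.filter fun σ => σ.card = 2).card : ℤ) +
    ((K.filter fun σ => σ.card = 3).card : ℤ)

/-- A combinatorial 2-sphere: a connected combinatorial 2-manifold with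
Euler characteristic 2. -/
def Comb2Sphere (K : Complex α) : Prop := Comb2Mfd K ∧ Conn K ∧ eulerChar K = 2

/-- A combinatorial 3-manifold: a 3-pseudomanifold all whose vertex links are
combinatorial 2-spheres. -/
def Comb3Mfd (K : Complex α) : Prop :=
  IsPM K 3 ∧ ∀ v, ({v} : Finset α) ∈ K → Comb2Sphere (link K {v})

end NPM


namespace NPM

section

variable {α : Type*} {M : Complex α}

theorem IsComplex.mem_of_subset (hM : IsComplex M) {σ τ : Finset α} (hσ : σ ∈ M)
    (hτ : τ ⊆ σ) (hne : τ.Nonempty) : τ ∈ M :=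
  hM.2.2 σ hσ τ hτ hne

variable [DecidableEq α]

theorem mem_verts_iff {v : α} : v ∈ verts M ↔ ∃ σ ∈ M, v ∈ σ := by
  simp [verts, Finset.mem_sup]

/-- In a complex, the vertices of the link of `{u}` are the neighbours of `u`. -/
theorem mem_verts_link_singleton (hM : IsComplex M) {u v : α} :
    v ∈ verts (link M {u}) ↔ v ≠ u ∧ ({u, v} : Finset α) ∈ M := by
  rw [mem_verts_iff]
  constructor
  · rintro ⟨σ, hσ, hv⟩
    simp only [link, Finset.mem_filter, Finset.disjoint_singleton_right] at hσ
    refine ⟨fun h => hσ.2.1 (h ▸ hv), hM.mem_of_subset hσ.2.2 ?_ (by simp)⟩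
    intro x hx
    grind
  · rintro ⟨hne, h⟩
    refine ⟨{v}, ?_, by simp⟩
    simp only [link, Finset.mem_filter, Finset.disjoint_singleton]
    refine ⟨hM.mem_of_subset h (by simp) (by simp), hne, ?_⟩
    simpa using h

theorem subset_insert_verts_link (hM : IsComplex M) {u : α} {σ : Finset α} (hσ : σ ∈ M)
    (hu : u ∈ σ) : σ ⊆ insert u (verts (link M {u})) := by
  intro v hv
  by_cases h : v = u
  · simp [h]
  · refine Finset.mem_insert_of_mem ((mem_verts_link_singleton hM).2 ⟨h, ?_⟩)
    exact hM.mem_of_subset hσ (by grind) (by simp)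

theorem exists_eq_insert_of_card {τ σ : Finset α} {d : ℕ} (hτ : τ.card = d)
    (hσ : σ.card = d + 1) (h : τ ⊆ σ) : ∃ w ∉ τ, σ = insert w τ := by
  obtain ⟨w, hw, rfl⟩ := (Finset.covBy_iff_exists_insert (s := τ) (t := σ)).1
    (Finset.covBy_iff_card_sdiff_eq_one.2 ⟨h, by rw [Finset.card_sdiff_of_subset h]; omega⟩)
  exact ⟨w, hw, rfl⟩

variable {d : ℕ}

/-- A `(d-1)`-face of a weak `d`-pseudomanifold has exactly two cofacets, described by the
vertices completing it to a facet. -/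
theorem WeakPM.exists_completions (hM : WeakPM M d) {τ : Finset α} (hτ : τ ∈ M)
    (hc : τ.card = d) :
    ∃ v w, v ≠ w ∧ ∀ x, (x ∉ τ ∧ insert x τ ∈ M) ↔ x = v ∨ x = w := by
  obtain ⟨σ, ρ, hne, h⟩ := Finset.card_eq_two.1 (hM.2.2 τ hτ hc)
  have key : ∀ ω, (ω ∈ M ∧ τ ⊆ ω ∧ ω.card = d + 1) ↔ ω = σ ∨ ω = ρ := fun ω => by
    simpa using congrArg (ω ∈ ·) h
  obtain ⟨-, h1, h2⟩ := (key σ).2 (Or.inl rfl)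
  obtain ⟨-, h3, h4⟩ := (key ρ).2 (Or.inr rfl)
  obtain ⟨v, hv, rfl⟩ := exists_eq_insert_of_card hc h2 h1
  obtain ⟨w, hw, rfl⟩ := exists_eq_insert_of_card hc h4 h3
  have inj : ∀ {x y}, x ∉ τ → insert x τ = insert y τ → x = y := fun {x y} hx h =>
    (Finset.insert_inj hx).1 h
  refine ⟨v, w, fun h => hne (h ▸ rfl), fun x => ⟨fun ⟨hx, hxM⟩ => ?_, ?_⟩⟩
  · rcases (key _).1 ⟨hxM, Finset.subset_insert _ _, by rw [Finset.card_insert_of_notMem hx, hc]⟩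
      with h | h
    · exact Or.inl (inj hx h)
    · exact Or.inr (inj hx h)
  · rintro (rfl | rfl)
    · exact ⟨hv, ((key _).2 (Or.inl rfl)).1⟩
    · exact ⟨hw, ((key _).2 (Or.inr rfl)).1⟩

theorem SConn.subset_of_closed (hM : IsPM M d) {W σ₀ : Finset α} (h₀ : σ₀ ∈ facets M d)
    (h₀W : σ₀ ⊆ W)
    (hW : ∀ τ ∈ M, τ.card = d → ∀ σ ∈ facets M d, ∀ ρ ∈ facets M d, τ ⊆ σ → τ ⊆ ρ → σ ⊆ W →
      ρ ⊆ W) (hd : d ≠ 0) : verts M ⊆ W := by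
  have hall : ∀ σ ∈ facets M d, σ ⊆ W := by
    intro σ hσ
    induction hM.2 σ₀ h₀ σ hσ with
    | refl => exact h₀W
    | tail _ h ih =>
      obtain ⟨ha, hb, hc⟩ := h
      refine hW _ ?_ hc _ ha _ hb Finset.inter_subset_left Finset.inter_subset_right (ih ha)
      exact hM.1.1.mem_of_subset (Finset.mem_filter.1 ha).1 Finset.inter_subset_left
        (Finset.card_pos.1 (by omega))
  intro v hv
  obtain ⟨σ, hσ, hvσ⟩ := mem_verts_iff.1 hv
  obtain ⟨ρ, hρ, hσρ, hcard⟩ := hM.1.2.1 σ hσ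
  exact hall ρ (Finset.mem_filter.2 ⟨hρ, hcard⟩) (hσρ hvσ)

theorem insert_sdiff_pair {V : Finset α} {p q : α} (hp : p ∈ V) (hpq : p ≠ q) :
    insert p (V \ {p, q}) = V.erase q := by
  ext x
  simp only [Finset.mem_insert, Finset.mem_sdiff, Finset.mem_singleton, Finset.mem_erase]
  grind

theorem insert_sdiff_triple {V : Finset α} {p q r : α} (hp : p ∈ V) (hpq : p ≠ q) (hpr : p ≠ r) :
    insert p (V \ {p, q, r}) = V \ {q, r} := by
  ext x
  simp only [Finset.mem_insert, Finset.mem_sdiff, Finset.mem_singleton]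
  grind

/-- If every triangle in the link of a vertex of degree 5 has both its cofacets in the star's
vertex set, then this vertex set is everything. -/
theorem verts_subset_of_cofacets_subset (hM : IsPM M 3) {u : α} (hu : u ∈ verts M)
    (hd : degree M {u} = 5)
    (hW : ∀ τ : Finset α, τ.card = 3 → u ∉ τ → insert u τ ∈ M → ∀ x ∉ τ, insert x τ ∈ M →
      x ∈ insert u (verts (link M {u}))) :
    verts M ⊆ insert u (verts (link M {u})) := by
  have hC := hM.1.1
  have hstar : ∀ {σ}, σ ∈ M → u ∈ σ → σ ⊆ insert u (verts (link M {u})) :=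
    fun h h' => subset_insert_verts_link hC h h'
  have huV : u ∉ verts (link M {u}) := fun h => ((mem_verts_link_singleton hC).1 h).1 rfl
  unfold degree at hd
  generalize verts (link M {u}) = V at *
  -- A triangle of the link is recorded by the pair `p, q` of vertices of the link it misses.
  have hH : ∀ p ∈ V, ∀ q ∈ V, ∀ r ∈ V, p ≠ q → q ≠ r → p ≠ r →
      insert u (V \ {p, q}) ∈ M → insert u (V \ {p, r}) ∈ M ∨ insert u (V \ {q, r}) ∈ M := by
    intro p hp q hq r hr hpq hqr hpr h
    have hc : (insert u (V \ {p, q, r})).card = 3 := by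
      rw [Finset.card_insert_of_notMem (by grind), Finset.card_sdiff_of_subset (by grind), hd,
        Finset.card_eq_three.2 ⟨p, q, r, hpq, hpr, hqr, rfl⟩]
    obtain ⟨v, w, hvw, hx⟩ := hM.1.exists_completions
      (hC.mem_of_subset h (by grind) (by simp)) hc
    have e1 : insert p (insert u (V \ {p, q, r})) = insert u (V \ {q, r}) := by
      rw [Finset.insert_comm, insert_sdiff_triple hp hpq hpr]
    have e2 : insert q (insert u (V \ {p, q, r})) = insert u (V \ {p, r}) := by
      rw [Finset.insert_comm, Finset.insert_comm p q, insert_sdiff_triple hq hpq.symm hqr]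
    have hloc : ∀ x, x ∉ insert u (V \ {p, q, r}) → insert x (insert u (V \ {p, q, r})) ∈ M →
        x = p ∨ x = q ∨ x = r := fun x h1 h2 => by
      have := hstar h2 (by simp) (Finset.mem_insert_self _ _)
      grind
    have hv := (hx v).2 (Or.inl rfl)
    have hw := (hx w).2 (Or.inr rfl)
    have hv' := hloc v hv.1 hv.2
    have hw' := hloc w hw.1 hw.2
    rw [← e1, ← e2]
    grind
  have hG : ∀ p ∈ V, ∀ q ∈ V, p ≠ q → insert u (V \ {p, q}) ∈ M →
      (V.erase p ∈ M ↔ V.erase q ∉ M) := by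
    intro p hp q hq hpq h
    have hc : (V \ {p, q}).card = 3 := by
      rw [Finset.card_sdiff_of_subset (by grind), hd, Finset.card_pair hpq]
    obtain ⟨v, w, hvw, hx⟩ := hM.1.exists_completions
      (hC.mem_of_subset h (by grind) (Finset.card_pos.1 (by omega))) hc
    have e1 : insert p (V \ {p, q}) = V.erase q := insert_sdiff_pair hp hpq
    have e2 : insert q (V \ {p, q}) = V.erase p := by
      rw [Finset.pair_comm, insert_sdiff_pair hq hpq.symm]
    have hloc := hW _ hc (by grind) h
    have hv := (hx v).2 (Or.inl rfl)
    have hw := (hx w).2 (Or.inr rfl)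
    have hv' := hloc v hv.1 hv.2
    have hw' := hloc w hw.1 hw.2
    have hu' := (hx u).1 ⟨by grind, h⟩
    have hp' := hx p
    have hq' := hx q
    rw [e1] at hp'
    rw [e2] at hq'
    grind
  obtain ⟨σ, hσ, huσ⟩ := mem_verts_iff.1 hu
  obtain ⟨σ₀, h₀, hσ₀, hc₀⟩ := hM.1.2.1 σ hσ
  have hu₀ : u ∈ σ₀ := hσ₀ huσ
  have pair : ∀ τ ⊆ V, τ.card = 3 → ∃ p ∈ V, ∃ q ∈ V, p ≠ q ∧ τ = V \ {p, q} := by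
    intro τ hτ hc
    obtain ⟨p, q, hpq, h⟩ := Finset.card_eq_two.1
      (show (V \ τ).card = 2 by rw [Finset.card_sdiff_of_subset hτ]; omega)
    have hsub : ({p, q} : Finset α) ⊆ V := h ▸ Finset.sdiff_subset
    refine ⟨p, hsub (by simp), q, hsub (by simp), hpq, ?_⟩
    rw [← h, Finset.sdiff_sdiff_eq_self hτ]
  obtain ⟨r, hr, s, hs, hrs, hrsM⟩ : ∃ r ∈ V, ∃ s ∈ V, r ≠ s ∧ insert u (V \ {r, s}) ∈ M := by
    obtain ⟨r, hr, s, hs, hrs, h⟩ := pair (σ₀.erase u)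
      (by have := hstar h₀ hu₀; grind) (by rw [Finset.card_erase_of_mem hu₀]; omega)
    exact ⟨r, hr, s, hs, hrs, by rwa [← h, Finset.insert_erase hu₀]⟩
  have hsymm : ∀ p q, V \ {p, q} = V \ {q, p} := fun p q => by rw [Finset.pair_comm]
  have hnot : ∀ p ∈ V, ∀ q ∈ V, p ≠ q → insert u (V \ {p, q}) ∉ M →
      (V.erase p ∈ M ↔ V.erase q ∈ M) := by
    intro p hp q hq hpq h
    obtain ⟨t, ht, hpt, h1⟩ : ∃ t ∈ V, p ≠ t ∧ insert u (V \ {p, t}) ∈ M := by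
      by_cases hpr : p = r
      · exact ⟨s, hs, hpr ▸ hrs, hpr ▸ hrsM⟩
      by_cases hps : p = s
      · exact ⟨r, hr, hpr, by rw [hps, hsymm]; exact hrsM⟩
      rcases hH r hr s hs p hp hrs (Ne.symm hps) (Ne.symm hpr) hrsM with h | h
      · exact ⟨r, hr, hpr, hsymm p r ▸ h⟩
      · exact ⟨s, hs, hps, hsymm p s ▸ h⟩
    have hqt : q ≠ t := fun e => h (e ▸ h1)
    have h2 := (hH p hp t ht q hq hpt (Ne.symm hqt) hpq h1).resolve_left h
    rw [hG p hp t ht hpt h1, hG t ht q hq (Ne.symm hqt) h2, not_not]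
  refine SConn.subset_of_closed hM (Finset.mem_filter.2 ⟨h₀, hc₀⟩) (hstar h₀ hu₀) ?_ (by decide)
  intro τ hτ hc σ hσ ρ hρ hτσ hτρ hσW
  simp only [facets, Finset.mem_filter] at hσ hρ
  by_cases huρ : u ∈ ρ
  · exact hstar hρ.1 huρ
  obtain ⟨y, hy, rfl⟩ := exists_eq_insert_of_card hc hρ.2 hτρ
  obtain ⟨x, hx, rfl⟩ := exists_eq_insert_of_card hc hσ.2 hτσ
  have hτV : τ ⊆ V := by grind
  suffices y ∈ insert u V by grind
  obtain ⟨p, hp, q, hq, hpq, rfl⟩ := pair τ hτV hc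
  by_cases h : insert u (V \ {p, q}) ∈ M
  · exact hW _ hc (by grind) h y hy hρ.1
  have hiff := hnot p hp q hq hpq h
  have e1 : insert p (V \ {p, q}) = V.erase q := insert_sdiff_pair hp hpq
  have e2 : insert q (V \ {p, q}) = V.erase p := by
      rw [Finset.pair_comm, insert_sdiff_pair hq hpq.symm]
  obtain ⟨v, w, hvw, hz⟩ := hM.1.exists_completions hτ hc
  have hp' := hz p
  have hq' := hz q
  have hy' := (hz y).1 ⟨hy, hρ.1⟩
  rw [e1] at hp'
  rw [e2] at hq'
  have hxu : x ≠ u := fun e => h (e ▸ hσ.1)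
  have hxV : x ∈ V := Finset.mem_of_mem_insert_of_ne (hσW (Finset.mem_insert_self _ _)) hxu
  have hxpq : x = p ∨ x = q := by
    by_contra hne
    exact hx (by simp [hxV, hne])
  have hmem : V.erase p ∈ M ∧ V.erase q ∈ M := by
    rcases hxpq with rfl | rfl
    · have := e1 ▸ hσ.1
      exact ⟨hiff.2 this, this⟩
    · have := e2 ▸ hσ.1
      exact ⟨this, hiff.1 this⟩
  have hpvw := hp'.1 ⟨by simp, hmem.2⟩
  have hqvw := hq'.1 ⟨by simp, hmem.1⟩
  have hypq : y = p ∨ y = q := by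
    clear * - hy' hpvw hqvw hpq
    grind
  rcases hypq with rfl | rfl
  · exact Finset.mem_insert_of_mem hp
  · exact Finset.mem_insert_of_mem hq

theorem mem_genCx {F : Finset (Finset α)} {τ : Finset α} :
    τ ∈ genCx F ↔ τ.Nonempty ∧ ∃ σ ∈ F, τ ⊆ σ := by
  simp only [genCx, Finset.mem_biUnion, Finset.mem_filter, Finset.mem_powerset]
  grind

theorem isComplex_genCx {F : Finset (Finset α)} (h : ∃ σ ∈ F, σ.Nonempty) :
    IsComplex (genCx F) := by
  obtain ⟨σ, hσ, hne⟩ := h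
  refine ⟨⟨σ, mem_genCx.2 ⟨hne, σ, hσ, subset_rfl⟩⟩, fun τ hτ => (mem_genCx.1 hτ).1, ?_⟩
  intro τ hτ ρ hρ hρne
  obtain ⟨-, ω, hω, h⟩ := mem_genCx.1 hτ
  exact mem_genCx.2 ⟨hρne, ω, hω, hρ.trans h⟩

/-- The link of a 2-face with completing vertices `u, v` is the 0-sphere on `{u, v}`. -/
theorem link_eq_stdSphere_pair (hM : WeakPM M d) {β : Finset α} (hβ : β ∈ M)
    (hc : β.card = d) {u v : α} (huv : u ≠ v) (huβ : u ∉ β) (hvβ : v ∉ β)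
    (hu : insert u β ∈ M) (hv : insert v β ∈ M) :
    link M β = stdSphere {u, v} := by
  obtain ⟨a, b, hab, hx⟩ := hM.exists_completions hβ hc
  have hx' : ∀ x, (x ∉ β ∧ insert x β ∈ M) ↔ x = u ∨ x = v := by
    have := (hx u).1 ⟨huβ, hu⟩
    have := (hx v).1 ⟨hvβ, hv⟩
    intro x
    rw [hx x]
    grind
  ext τ
  simp only [link, stdSphere, Finset.mem_filter, Finset.mem_powerset]
  constructor
  · rintro ⟨hτ, hdis, hun⟩
    refine ⟨fun x hxτ => ?_, hM.1.2.1 τ hτ, ?_⟩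
    · have : x ∉ β ∧ insert x β ∈ M := ⟨Finset.disjoint_left.1 hdis hxτ,
        hM.1.mem_of_subset hun (by grind) (by simp)⟩
      simpa using (hx' x).1 this
    · rintro rfl
      obtain ⟨ρ, hρ, hsub, hcard⟩ := hM.2.1 _ hun
      have := Finset.card_le_card hsub
      rw [Finset.card_union_of_disjoint hdis.symm, Finset.card_pair huv] at this
      omega
  · rintro ⟨hsub, hne, hneq⟩
    obtain ⟨x, hxuv, rfl⟩ : ∃ x, (x = u ∨ x = v) ∧ τ = {x} := by
      obtain ⟨x, hx⟩ := hne
      exact ⟨x, by grind, by grind⟩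
    obtain ⟨h1, h2⟩ := (hx' x).2 hxuv
    refine ⟨hM.1.mem_of_subset h2 (by simp) (by simp), by simpa using h1, ?_⟩
    rwa [Finset.union_comm, ← Finset.insert_eq]

/-- A bistellar 1-move on a 2-face of the link of `u` adds one neighbour to `u`. -/
theorem verts_link_genCx (hM : WeakPM M 3) {β : Finset α} (hc : β.card = 3) {u v : α}
    (huv : u ≠ v) (huβ : u ∉ β) (hvβ : v ∉ β) (hu : insert u β ∈ M) :
    verts (link (genCx ((facets M 3).filter (fun σ => ¬ β ⊆ σ) ∪
      β.image fun w => (({u, v} : Finset α) ∪ β).erase w)) {u}) =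
      insert v (verts (link M {u})) := by
  set F := (facets M 3).filter (fun σ => ¬ β ⊆ σ) ∪
      β.image fun w => (({u, v} : Finset α) ∪ β).erase w with hF
  have hmem : ∀ σ, σ ∈ F ↔ (σ ∈ M ∧ σ.card = 4 ∧ ¬ β ⊆ σ) ∨
      ∃ w ∈ β, (({u, v} : Finset α) ∪ β).erase w = σ := by
    intro σ
    simp [hF, facets, and_assoc]
  obtain ⟨a, b, c, hab, hac, hbc, rfl⟩ := Finset.card_eq_three.1 hc
  have hnew : ∀ x ∈ ({a, b, c, v} : Finset α), ∃ σ ∈ F, {u, x} ⊆ σ := by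
    intro x hx
    by_cases h : x = a
    · exact ⟨_, (hmem _).2 (Or.inr ⟨b, by simp, rfl⟩), by grind⟩
    · exact ⟨_, (hmem _).2 (Or.inr ⟨a, by simp, rfl⟩), by grind⟩
  have hCN : IsComplex (genCx F) := isComplex_genCx <| by
    obtain ⟨σ, hσ, h⟩ := hnew v (by simp)
    exact ⟨σ, hσ, u, h (by simp)⟩
  ext x
  rw [mem_verts_link_singleton hCN, Finset.mem_insert, mem_verts_link_singleton hM.1, mem_genCx]
  constructor
  · rintro ⟨hxu, -, σ, hσ, hsub⟩
    rcases (hmem σ).1 hσ with ⟨hσM, -, -⟩ | ⟨w, hw, rfl⟩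
    · exact Or.inr ⟨hxu, hM.1.mem_of_subset hσM hsub (by simp)⟩
    · by_cases hxv : x = v
      · exact Or.inl hxv
      · exact Or.inr ⟨hxu, hM.1.mem_of_subset hu (by grind) (by simp)⟩
  · intro h
    refine ⟨by grind, by simp, ?_⟩
    by_cases hx : x ∈ ({a, b, c, v} : Finset α)
    · exact hnew x hx
    obtain ⟨hxu, hxM⟩ : x ≠ u ∧ ({u, x} : Finset α) ∈ M := by grind
    obtain ⟨σ, hσ, hsub, hcard⟩ := hM.2.1 _ hxM
    refine ⟨σ, (hmem σ).2 (Or.inl ⟨hσ, hcard, fun hβ => ?_⟩), hsub⟩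
    have h5 : (insert x (insert u ({a, b, c} : Finset α))).card = 5 := by
      rw [Finset.card_insert_of_notMem (by grind), Finset.card_insert_of_notMem huβ, hc]
    have := Finset.card_le_card (show insert x (insert u ({a, b, c} : Finset α)) ⊆ σ by grind)
    omega

end

end NPM

/-- in a 3-pseudomanifold with at least 7 vertices, a vertex of
degree 5 can be given degree 6 by a single bistellar 1-move. -/
theorem statement15 {α : Type u} [DecidableEq α] (M : NPM.Complex α)
    (hM : NPM.IsPM M 3) (hn : 7 ≤ (NPM.verts M).card)
    (u : α) (hu : u ∈ NPM.verts M) (hd : NPM.degree M {u} = 5) :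
    ∃ N : NPM.Complex α, NPM.BMove 3 1 M N ∧ NPM.degree N {u} = 6 := by
  have hC := hM.1.1
  obtain ⟨β, hc, huβ, huM, v, hvβ, hvM, hv⟩ : ∃ β : Finset α, β.card = 3 ∧ u ∉ β ∧
      insert u β ∈ M ∧ ∃ v ∉ β, insert v β ∈ M ∧ v ∉ insert u (NPM.verts (NPM.link M {u})) := by
    by_contra! hcon
    have hle := Finset.card_le_card (NPM.verts_subset_of_cofacets_subset hM hu hd hcon)
    have := Finset.card_insert_le u (NPM.verts (NPM.link M {u}))
    unfold NPM.degree at hd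
    omega
  rw [Finset.mem_insert, not_or, NPM.mem_verts_link_singleton hC] at hv
  have huv : u ≠ v := Ne.symm hv.1
  have hβ : β ∈ M := hC.mem_of_subset huM (by simp) (Finset.card_pos.1 (by omega))
  refine ⟨_, ⟨β, {u, v}, hβ, hc, Finset.card_pair huv, fun h => hv.2 ⟨hv.1, h⟩,
    NPM.link_eq_stdSphere_pair hM.1 hβ hc huv huβ hvβ huM hvM, rfl⟩, ?_⟩
  rw [NPM.degree, NPM.verts_link_genCx hM.1 hc huv huβ hvβ huM, Finset.card_insert_of_notMem]
  · unfold NPM.degree at hd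
    omega
  · rw [NPM.mem_verts_link_singleton hC]
    exact hv.2
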